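/- In the stochastic SQP setting with adaptive (Adagrad-Norm-type) stepsizes described in the context, fix K ∈ ℕ with K ≥ 1 and define κ₇(K) := τ_min·(f(x₀) − f_low) + ‖c(x₀)‖₁ + κ₅·log(1 + κ_c·K/q₋₁²) + κ₆·log(1 + ζ⁻¹(κ_Hκ_u² + ζ⁻¹M)·K/b₋₁²). Then for every δ₁ ∈ (0,1) there exists a measurable event A with ℙ(A) ≥ 1 − δ₁ such that 𝔼[ 𝟙_A · (1/K)·∑_{k=0}^{K−1} ‖c(x_k)‖₁ ] ≤ 2·(ν·σ·q₋₁ + 2κ₇(K))·κ₇(K) / (ν²·σ²·δ₁·K). -/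

import Mathlib

open Matrix MeasureTheory RealInnerProductSpace

/-- The ℓ¹-norm of a vector in `ℝ^m`. -/
noncomputable def l1Norm {k : ℕ} (v : EuclideanSpace ℝ (Fin k)) : ℝ := ∑ i, |v i|

/-- The Jacobian matrix of `c` at `z`, whose rows are the gradients of the components. -/
noncomputable def Jmat {m n : ℕ}
    (gradc : Fin m → EuclideanSpace ℝ (Fin n) → EuclideanSpace ℝ (Fin n))
    (z : EuclideanSpace ℝ (Fin n)) : Matrix (Fin m) (Fin n) ℝ :=
  Matrix.of fun i j => gradc i z j

/-- The previous value of an accumulator sequence: `prevSeq init b k = b (k-1)`,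
with value `init` at `k = 0` (i.e. the "index `-1`" initial value). -/
noncomputable def prevSeq {Ω : Type*} (init : ℝ) (b : ℕ → Ω → ℝ) : ℕ → Ω → ℝ
  | 0 => fun _ => init
  | k + 1 => b k

/-- Logarithmic bound on a sum of terms normalized by their running total. -/
lemma sum_div_running_total_le_log {B : ℝ} (hB : 0 < B) {r : ℕ → ℝ} (hr : ∀ k, 0 ≤ r k) (K : ℕ) :
    ∑ k ∈ Finset.range K, r k / (B + ∑ j ∈ Finset.range (k + 1), r j)
      ≤ Real.log (1 + (∑ j ∈ Finset.range K, r j) / B) := by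
  induction K with
  | zero => simp
  | succ K ih =>
    have hS : 0 ≤ ∑ j ∈ Finset.range K, r j := Finset.sum_nonneg fun j _ => hr j
    rw [Finset.sum_range_succ, Finset.sum_range_succ (fun j => r j) K]
    set S := ∑ j ∈ Finset.range K, r j
    have hrK := hr K
    have hlog := Real.one_sub_inv_le_log_of_pos (x := (B + (S + r K)) / (B + S)) (by positivity)
    have hlogsub : Real.log ((B + (S + r K)) / (B + S))
        = Real.log (1 + (S + r K) / B) - Real.log (1 + S / B) := by
      rw [← Real.log_div (by positivity) (by positivity)]
      congr 1
      field_simp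
    have hterm : 1 - ((B + (S + r K)) / (B + S))⁻¹ = r K / (B + (S + r K)) := by
      field_simp
      ring
    linarith

/-- If `S` is a sum of nonnegative terms, it is controlled by the sum of the terms divided by
the square roots of their running totals. -/
lemma sum_le_of_sum_div_sqrt {a : ℝ} (ha : 0 < a) {r : ℕ → ℝ} (hr : ∀ k, 0 ≤ r k) (K : ℕ) :
    ∑ k ∈ Finset.range K, r k
      ≤ (a + ∑ k ∈ Finset.range K, r k / √(a ^ 2 + ∑ j ∈ Finset.range (k + 1), r j))
        * ∑ k ∈ Finset.range K, r k / √(a ^ 2 + ∑ j ∈ Finset.range (k + 1), r j) := by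
  set S := ∑ k ∈ Finset.range K, r k
  set T := ∑ k ∈ Finset.range K, r k / √(a ^ 2 + ∑ j ∈ Finset.range (k + 1), r j)
  have hS : 0 ≤ S := Finset.sum_nonneg fun j _ => hr j
  have hT : 0 ≤ T := Finset.sum_nonneg fun j _ => div_nonneg (hr j) (Real.sqrt_nonneg _)
  have hRpos : 0 < √(a ^ 2 + S) := Real.sqrt_pos.2 (by positivity)
  have hRsq : √(a ^ 2 + S) ^ 2 = a ^ 2 + S := Real.sq_sqrt (by positivity)
  set R := √(a ^ 2 + S) with hR
  have hST : S ≤ T * R := by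
    rw [← div_le_iff₀ hRpos, Finset.sum_div]
    refine Finset.sum_le_sum fun k hk => ?_
    have hk' : ∑ j ∈ Finset.range (k + 1), r j ≤ S :=
      Finset.sum_le_sum_of_subset_of_nonneg
        (Finset.range_subset_range.2 (Finset.mem_range.1 hk)) fun j _ _ => hr j
    have hk0 : 0 ≤ ∑ j ∈ Finset.range (k + 1), r j := Finset.sum_nonneg fun j _ => hr j
    have hpos : 0 < √(a ^ 2 + ∑ j ∈ Finset.range (k + 1), r j) := Real.sqrt_pos.2 (by positivity)
    exact div_le_div_of_nonneg_left (hr k) hpos (Real.sqrt_le_sqrt (by linarith))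
  have hRT : R ≤ a + T := by
    by_contra! h
    nlinarith
  calc S ≤ T * R := hST
    _ ≤ (a + T) * T := by nlinarith

/-- The square of an accumulator `b k = √(b (k-1) ^ 2 + r k)` is its initial square plus the
partial sum of the increments. -/
lemma accumulator_eq_sqrt {Ω : Type*} {init : ℝ} {b r : ℕ → Ω → ℝ} (hr : ∀ k ω, 0 ≤ r k ω)
    (hb : ∀ k ω, b k ω = √(prevSeq init b k ω ^ 2 + r k ω)) (k : ℕ) (ω : Ω) :
    b k ω = √(init ^ 2 + ∑ j ∈ Finset.range (k + 1), r j ω) := by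
  induction k with
  | zero => simp [hb 0 ω, prevSeq]
  | succ k ih =>
    have hs : 0 ≤ ∑ j ∈ Finset.range (k + 1), r j ω := Finset.sum_nonneg fun j _ => hr j ω
    rw [hb, prevSeq, ih, Real.sq_sqrt (by positivity), Finset.sum_range_succ _ (k + 1), add_assoc]

/-- First-order Taylor bound for a function with Lipschitz gradient. -/
lemma abs_sub_sub_inner_le {E : Type*} [NormedAddCommGroup E] [InnerProductSpace ℝ E]
    [CompleteSpace E] {h : E → ℝ} {grad : E → E} {C : ℝ}
    (hh : ∀ z, HasGradientAt h (grad z) z) (hLip : ∀ z z', ‖grad z - grad z'‖ ≤ C * ‖z - z'‖)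
    (z d : E) : |h (z + d) - h z - ⟪grad z, d⟫| ≤ C / 2 * ‖d‖ ^ 2 := by
  have hderiv : ∀ t : ℝ, HasDerivAt (fun t : ℝ => h (z + t • d) - h z - t * ⟪grad z, d⟫)
      (⟪grad (z + t • d), d⟫ - ⟪grad z, d⟫) t := by
    intro t
    have hline : HasDerivAt (fun t : ℝ => z + t • d) d t := by
      simpa using ((hasDerivAt_id t).smul_const d).const_add z
    have hcomp := (hh (z + t • d)).hasFDerivAt.comp_hasDerivAt t hline
    exact ((hcomp.sub_const (h z)).sub ((hasDerivAt_id t).mul_const ⟪grad z, d⟫)).congr_deriv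
      (by simp)
  have hbound : ∀ t : ℝ, HasDerivAt (fun t : ℝ => C / 2 * ‖d‖ ^ 2 * t ^ 2)
      (C * ‖d‖ ^ 2 * t) t := by
    intro t
    exact ((hasDerivAt_pow 2 t).const_mul (C / 2 * ‖d‖ ^ 2)).congr_deriv (by norm_num; ring)
  have key := image_norm_le_of_norm_deriv_right_le_deriv_boundary (a := (0 : ℝ)) (b := 1)
    (fun t _ => (hderiv t).continuousAt.continuousWithinAt)
    (fun t _ => (hderiv t).hasDerivWithinAt) (by simp) hbound
    (fun t ht => by
      rw [← inner_sub_left]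
      refine (norm_inner_le_norm _ _).trans ?_
      have h1 := hLip (z + t • d) z
      rw [add_sub_cancel_left, norm_smul, Real.norm_of_nonneg ht.1] at h1
      nlinarith [norm_nonneg d])
    (Set.right_mem_Icc.2 zero_le_one)
  simpa using key

lemma l1Norm_nonneg {k : ℕ} (w : EuclideanSpace ℝ (Fin k)) : 0 ≤ l1Norm w :=
  Finset.sum_nonneg fun _ _ => abs_nonneg _

lemma norm_le_l1Norm {k : ℕ} (w : EuclideanSpace ℝ (Fin k)) : ‖w‖ ≤ l1Norm w := by
  rw [EuclideanSpace.norm_eq]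
  refine Real.sqrt_le_iff.2 ⟨l1Norm_nonneg w, ?_⟩
  exact Finset.sum_sq_le_sq_sum_of_nonneg fun i _ => abs_nonneg _

lemma Jmat_apply {m n : ℕ} (gradc : Fin m → EuclideanSpace ℝ (Fin n) → EuclideanSpace ℝ (Fin n))
    (z d : EuclideanSpace ℝ (Fin n)) (i : Fin m) :
    Matrix.toEuclideanLin (Jmat gradc z) d i = ⟪gradc i z, d⟫ := by
  simp [Jmat, Matrix.toLpLin_apply, Matrix.mulVec, dotProduct, PiLp.inner_apply, mul_comm]

lemma inner_toEuclideanLin_transpose {m n : ℕ} (A : Matrix (Fin m) (Fin n) ℝ)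
    (w : EuclideanSpace ℝ (Fin n)) (z : EuclideanSpace ℝ (Fin m)) :
    ⟪w, Matrix.toEuclideanLin Aᵀ z⟫ = ⟪Matrix.toEuclideanLin A w, z⟫ := by
  have h := Matrix.toEuclideanLin_conjTranspose_eq_adjoint A
  rw [Matrix.conjTranspose_eq_transpose_of_trivial] at h
  rw [h, LinearMap.adjoint_inner_right]

/-- Change of the constraint violation along a step that solves the linearized constraints. -/
lemma l1Norm_step_le {m n : ℕ} {c : EuclideanSpace ℝ (Fin n) → EuclideanSpace ℝ (Fin m)}
    {gradc : Fin m → EuclideanSpace ℝ (Fin n) → EuclideanSpace ℝ (Fin n)} {γ : Fin m → ℝ}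
    (hc : ∀ i z, HasGradientAt (fun w => c w i) (gradc i z) z)
    (hcLip : ∀ i z z', ‖gradc i z - gradc i z'‖ ≤ γ i * ‖z - z'‖)
    {z d : EuclideanSpace ℝ (Fin n)} (hd : Matrix.toEuclideanLin (Jmat gradc z) d = -(c z))
    (a : ℝ) :
    l1Norm (c (z + a • d)) ≤ |1 - a| * l1Norm (c z) + (∑ i, γ i) / 2 * (a ^ 2 * ‖d‖ ^ 2) := by
  unfold l1Norm
  rw [Finset.mul_sum, Finset.sum_div, Finset.sum_mul, ← Finset.sum_add_distrib]
  refine Finset.sum_le_sum fun i _ => ?_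
  have hTaylor := abs_sub_sub_inner_le (hc i) (hcLip i) z (a • d)
  have hi : ⟪gradc i z, d⟫ = -(c z i) := by rw [← Jmat_apply, hd]; rfl
  rw [inner_smul_right, hi, norm_smul, mul_pow, Real.norm_eq_abs, sq_abs] at hTaylor
  rw [← abs_mul]
  have hsplit : c (z + a • d) i
      = (1 - a) * c z i + (c (z + a • d) i - c z i - a * -(c z i)) := by ring
  rw [hsplit]
  exact (abs_add_le _ _).trans (add_le_add_right hTaylor _)

/-- Vectors in the range of `Aᵀ` are bounded by their image under `A`. -/
lemma norm_le_of_mem_range_transpose {m n : ℕ} {A : Matrix (Fin m) (Fin n) ℝ} {s : ℝ} (hs : 0 < s)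
    (hsv : ∀ z : EuclideanSpace ℝ (Fin m), s * ‖z‖ ≤ ‖Matrix.toEuclideanLin Aᵀ z‖)
    {w : EuclideanSpace ℝ (Fin n)} (hw : ∃ z, w = Matrix.toEuclideanLin Aᵀ z) :
    ‖w‖ ≤ s⁻¹ * ‖Matrix.toEuclideanLin A w‖ := by
  obtain ⟨z, hz⟩ := hw
  have hzs := hsv z
  rw [← hz] at hzs
  have hsq : ‖w‖ ^ 2 ≤ ‖Matrix.toEuclideanLin A w‖ * ‖z‖ := by
    rw [← real_inner_self_eq_norm_sq]
    nth_rewrite 2 [hz]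
    rw [inner_toEuclideanLin_transpose]
    exact real_inner_le_norm _ _
  rw [inv_mul_eq_div, le_div_iff₀ hs]
  rcases (norm_nonneg w).eq_or_lt with h0 | h0
  · rw [← h0, zero_mul]; positivity
  · have := norm_nonneg (Matrix.toEuclideanLin A w)
    nlinarith

/-- A null-space vector whose image under `B` differs from `-h` by an element of `Range(Aᵀ)`
is bounded by `ζ⁻¹ ‖h‖`, when `B` is `ζ`-coercive on the null space of `A`. -/
lemma norm_le_of_coercive {m n : ℕ} {A : Matrix (Fin m) (Fin n) ℝ} {B : Matrix (Fin n) (Fin n) ℝ}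
    {ζ : ℝ} (hζ : 0 < ζ) {w h : EuclideanSpace ℝ (Fin n)} {z : EuclideanSpace ℝ (Fin m)}
    (hw : Matrix.toEuclideanLin A w = 0) (hB : ζ * ‖w‖ ^ 2 ≤ ⟪w, Matrix.toEuclideanLin B w⟫)
    (heq : Matrix.toEuclideanLin B w + Matrix.toEuclideanLin Aᵀ z = -h) :
    ‖w‖ ≤ ζ⁻¹ * ‖h‖ := by
  have hin : ⟪w, Matrix.toEuclideanLin B w⟫ = ⟪w, -h⟫ := by
    rw [← heq, inner_add_right, inner_toEuclideanLin_transpose, hw, inner_zero_left, add_zero]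
  have hle := real_inner_le_norm w (-h)
  rw [norm_neg] at hle
  rw [inv_mul_eq_div, le_div_iff₀ hζ]
  rcases (norm_nonneg w).eq_or_lt with h0 | h0
  · rw [← h0, zero_mul]; positivity
  · nlinarith

/-- Tangent-line bound for the logarithm. -/
lemma log_one_add_le_tangent {X a : ℝ} (hX : 0 ≤ X) (ha : 0 ≤ a) :
    Real.log (1 + X) ≤ Real.log (1 + a) + (X - a) / (1 + a) := by
  have h := Real.log_le_sub_one_of_pos (x := (1 + X) / (1 + a)) (by positivity)
  rw [Real.log_div (by positivity) (by positivity)] at h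
  have : (1 + X) / (1 + a) - 1 = (X - a) / (1 + a) := by field_simp; ring
  linarith

lemma log_one_add_two_mul_le {a : ℝ} (ha : 0 ≤ a) :
    Real.log (1 + 2 * a) ≤ 2 * Real.log (1 + a) := by
  have h : Real.log ((1 + a) ^ 2) = 2 * Real.log (1 + a) := by rw [Real.log_pow]; norm_num
  rw [← h]
  exact Real.log_le_log (by positivity) (by nlinarith [sq_nonneg a])

/-- Per-step decrease of the constraint violation `r` in terms of the accumulators. -/
lemma violation_recursion_le {ν θ η κv Γ q₀ q b a r w t : ℝ} (hν : 0 < ν) (hθ : 0 < θ)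
    (hκv : 0 ≤ κv) (hΓ : 0 ≤ Γ) (hq₀ : 0 < q₀) (hq : q₀ ≤ q) (hr : 0 ≤ r) (hw : 0 ≤ w)
    (ht : t ≤ κv * r) (ha₁ : ν / q ≤ a) (ha₂ : a ≤ (ν + θ) / q) :
    |1 - a| * r + Γ / 2 * (a ^ 2 * ((η / b) ^ 2 * w + t))
      ≤ r - ν * (r / q) + (ν + θ) ^ 2 * (κv * Γ + 4) / 2 * (r / q ^ 2)
        + η ^ 2 * (ν + θ) ^ 2 * Γ / (2 * q₀ ^ 2) * (w / b ^ 2) := by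
  have hqpos : 0 < q := hq₀.trans_le hq
  have ha : 0 ≤ a := le_trans (by positivity) ha₁
  have ha2 : a ^ 2 ≤ (ν + θ) ^ 2 / q ^ 2 := by rw [← div_pow]; gcongr
  have ha2' : a ^ 2 ≤ (ν + θ) ^ 2 / q₀ ^ 2 := ha2.trans (by gcongr)
  have habs : |1 - a| ≤ 1 - a + 2 * a ^ 2 := by
    rw [abs_le]
    constructor <;> nlinarith [sq_nonneg (a - 1)]
  have hnu : ν * (r / q) ≤ a * r := by
    calc ν * (r / q) = ν / q * r := by ring
      _ ≤ a * r := by gcongr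
  have h1 : |1 - a| * r ≤ (1 - a + 2 * a ^ 2) * r := by gcongr
  have h2 : a ^ 2 * r ≤ (ν + θ) ^ 2 / q ^ 2 * r := by gcongr
  have h3 : Γ / 2 * (a ^ 2 * t) ≤ Γ / 2 * ((ν + θ) ^ 2 / q ^ 2 * (κv * r)) := by
    have ht' : a ^ 2 * t ≤ a ^ 2 * (κv * r) := by gcongr
    have har : a ^ 2 * (κv * r) ≤ (ν + θ) ^ 2 / q ^ 2 * (κv * r) := by gcongr
    exact mul_le_mul_of_nonneg_left (ht'.trans har) (by positivity)
  have h4 : Γ / 2 * (a ^ 2 * ((η / b) ^ 2 * w))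
      ≤ Γ / 2 * ((ν + θ) ^ 2 / q₀ ^ 2 * ((η / b) ^ 2 * w)) := by gcongr
  have e3 : (ν + θ) ^ 2 * (κv * Γ + 4) / 2 * (r / q ^ 2)
      = Γ / 2 * ((ν + θ) ^ 2 / q ^ 2 * (κv * r)) + 2 * ((ν + θ) ^ 2 / q ^ 2 * r) := by ring
  have e4 : η ^ 2 * (ν + θ) ^ 2 * Γ / (2 * q₀ ^ 2) * (w / b ^ 2)
      = Γ / 2 * ((ν + θ) ^ 2 / q₀ ^ 2 * ((η / b) ^ 2 * w)) := by
    rw [div_pow]; field_simp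
  rw [e3, e4]
  linarith

/-- Summing the one-step recursion gives a logarithmic bound on the scaled violations. -/
lemma sum_div_sqrt_le_of_recursion {ν P Q q₀ b₀ : ℝ} (hP : 0 ≤ P) (hQ : 0 ≤ Q)
    (hq₀ : 0 < q₀) (hb₀ : 0 < b₀) {r w q b : ℕ → ℝ} (hr : ∀ k, 0 ≤ r k) (hw : ∀ k, 0 ≤ w k)
    (hq : ∀ k, q k = √(q₀ ^ 2 + ∑ j ∈ Finset.range (k + 1), r j))
    (hb : ∀ k, b k = √(b₀ ^ 2 + ∑ j ∈ Finset.range (k + 1), w j))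
    (hrec : ∀ k, r (k + 1) ≤ r k - ν * (r k / q k) + P * (r k / q k ^ 2) + Q * (w k / b k ^ 2))
    (K : ℕ) :
    ν * ∑ k ∈ Finset.range K, r k / q k
      ≤ r 0 + P * Real.log (1 + (∑ k ∈ Finset.range K, r k) / q₀ ^ 2)
        + Q * Real.log (1 + (∑ k ∈ Finset.range K, w k) / b₀ ^ 2) := by
  have hsq : ∀ {a : ℝ} {z : ℕ → ℝ}, (∀ k, 0 ≤ z k) → ∀ k,
      √(a ^ 2 + ∑ j ∈ Finset.range (k + 1), z j) ^ 2
        = a ^ 2 + ∑ j ∈ Finset.range (k + 1), z j := fun hz k =>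
    Real.sq_sqrt (add_nonneg (sq_nonneg _) (Finset.sum_nonneg fun j _ => hz j))
  have hlogq := sum_div_running_total_le_log (pow_pos hq₀ 2) hr K
  have hlogb := sum_div_running_total_le_log (pow_pos hb₀ 2) hw K
  have htel : ∀ N : ℕ, r N + ν * ∑ k ∈ Finset.range N, r k / q k
      ≤ r 0 + P * ∑ k ∈ Finset.range N, r k / (q₀ ^ 2 + ∑ j ∈ Finset.range (k + 1), r j)
        + Q * ∑ k ∈ Finset.range N, w k / (b₀ ^ 2 + ∑ j ∈ Finset.range (k + 1), w j) := by
    intro N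
    induction N with
    | zero => simp
    | succ N ih =>
      have h := hrec N
      have hqN : q N ^ 2 = q₀ ^ 2 + ∑ j ∈ Finset.range (N + 1), r j := by rw [hq, hsq hr]
      have hbN : b N ^ 2 = b₀ ^ 2 + ∑ j ∈ Finset.range (N + 1), w j := by rw [hb, hsq hw]
      rw [hqN, hbN] at h
      rw [Finset.sum_range_succ, Finset.sum_range_succ (fun k => r k / (q₀ ^ 2 + _)),
        Finset.sum_range_succ (fun k => w k / (b₀ ^ 2 + _))]
      linarith
  have h1 := mul_le_mul_of_nonneg_left hlogq hP
  have h2 := mul_le_mul_of_nonneg_left hlogb hQ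
  linarith [htel K, hr K]

lemma integral_const_add_const_mul {Ω : Type*} {m0 : MeasurableSpace Ω} (μ : Measure Ω)
    [IsProbabilityMeasure μ] {F : Ω → ℝ} (hF : Integrable F μ) (p t : ℝ) :
    ∫ ω, (p + t * F ω) ∂μ = p + t * ∫ ω, F ω ∂μ := by
  rw [integral_add (integrable_const p) (hF.const_mul t), integral_const_mul]
  simp

/-- Markov's inequality turned into a high-probability bound for a running sum: if `T` has
expectation at most `E` and `S ≤ (a + T) T`, then off an event of probability at most `δ` the
expectation of `S` is at most `(a + E / δ) E`. -/
lemma exists_event_setIntegral_le {Ω : Type*} {m0 : MeasurableSpace Ω} (μ : Measure Ω)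
    [IsProbabilityMeasure μ] {S T : Ω → ℝ} {a E δ : ℝ} (hE : 0 < E) (ha : 0 ≤ a) (hδ : 0 < δ)
    (hTm : Measurable T) (hT0 : ∀ ω, 0 ≤ T ω) (hTi : Integrable T μ) (hSi : Integrable S μ)
    (hTE : ∫ ω, T ω ∂μ ≤ E) (hST : ∀ ω, S ω ≤ (a + T ω) * T ω) :
    ∃ A : Set Ω, MeasurableSet A ∧ ENNReal.ofReal (1 - δ) ≤ μ A ∧
      ∫ ω in A, S ω ∂μ ≤ (a + E / δ) * E := by
  have hm : MeasurableSet {ω | T ω ≤ E / δ} := measurableSet_le hTm measurable_const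
  refine ⟨{ω | T ω ≤ E / δ}, hm, ?_, ?_⟩
  · have hmarkov := mul_meas_ge_le_integral_of_nonneg (Filter.Eventually.of_forall hT0) hTi (E / δ)
    have hcompl : μ.real {ω | T ω ≤ E / δ}ᶜ ≤ μ.real {ω | E / δ ≤ T ω} :=
      measureReal_mono fun ω hω => by
        have h : ¬ T ω ≤ E / δ := hω
        exact (not_le.1 h).le
    have hle : μ.real {ω | E / δ ≤ T ω} ≤ δ := by
      have h := hmarkov.trans hTE
      rw [div_mul_eq_mul_div, div_le_iff₀ hδ] at h
      exact le_of_mul_le_mul_left h hE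
    rw [probReal_compl_eq_one_sub hm] at hcompl
    rw [← ofReal_measureReal]
    exact ENNReal.ofReal_le_ofReal (by linarith)
  · have hmono : ∫ ω in {ω | T ω ≤ E / δ}, S ω ∂μ
        ≤ ∫ ω in {ω | T ω ≤ E / δ}, (a + E / δ) * T ω ∂μ := by
      refine setIntegral_mono_on hSi.integrableOn (hTi.const_mul _).integrableOn hm fun ω hω => ?_
      have hω' : T ω ≤ E / δ := hω
      exact (hST ω).trans (mul_le_mul_of_nonneg_right (by linarith) (hT0 ω))
    refine hmono.trans ?_
    rw [integral_const_mul]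
    have hsub : ∫ ω in {ω | T ω ≤ E / δ}, T ω ∂μ ≤ ∫ ω, T ω ∂μ :=
      setIntegral_le_integral hTi (Filter.Eventually.of_forall hT0)
    exact mul_le_mul_of_nonneg_left (hsub.trans hTE) (by positivity)

/-- Second-moment splitting of the tangential step into its noiseless and noise parts. -/
lemma sq_norm_tangential_le {m n : ℕ} {A : Matrix (Fin m) (Fin n) ℝ}
    {B : Matrix (Fin n) (Fin n) ℝ} {ζ κH κu : ℝ} (hζ : 0 < ζ) (hκH : 0 ≤ κH)
    (hB : ∀ z : EuclideanSpace ℝ (Fin n), ‖Matrix.toEuclideanLin B z‖ ≤ κH * ‖z‖)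
    (hpd : ∀ z : EuclideanSpace ℝ (Fin n), Matrix.toEuclideanLin A z = 0 →
      ζ * ‖z‖ ^ 2 ≤ ⟪z, Matrix.toEuclideanLin B z⟫)
    {u ut v g g' : EuclideanSpace ℝ (Fin n)} {y yt : EuclideanSpace ℝ (Fin m)}
    (hu : Matrix.toEuclideanLin A u = 0) (hut : Matrix.toEuclideanLin A ut = 0)
    (hsys : Matrix.toEuclideanLin B (u + v) + Matrix.toEuclideanLin Aᵀ y = -g)
    (hsyst : Matrix.toEuclideanLin B (ut + v) + Matrix.toEuclideanLin Aᵀ yt = -g')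
    (hκu : ζ⁻¹ * (‖g'‖ + κH * ‖v‖) ≤ κu) :
    ‖u‖ ^ 2 ≤ 2 * (ζ⁻¹ * κH * κu ^ 2 + ζ⁻¹ * ζ⁻¹ * ‖g - g'‖ ^ 2) := by
  have hutle : ‖ut‖ ≤ κu := by
    have h : ‖ut‖ ≤ ζ⁻¹ * ‖g' + Matrix.toEuclideanLin B v‖ :=
      norm_le_of_coercive hζ hut (hpd ut hut) (z := yt) (by
        rw [neg_add, ← hsyst, map_add]; abel)
    refine h.trans (le_trans ?_ hκu)
    gcongr
    exact (norm_add_le _ _).trans (add_le_add_right (hB v) _)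
  have hutsq : ‖ut‖ ^ 2 ≤ ζ⁻¹ * κH * κu ^ 2 := by
    have h1 := hpd ut hut
    have h2 := real_inner_le_norm ut (Matrix.toEuclideanLin B ut)
    have h3 := mul_le_mul_of_nonneg_left (hB ut) (norm_nonneg ut)
    have h4 : ζ * ‖ut‖ ^ 2 ≤ κH * ‖ut‖ ^ 2 := by nlinarith
    have h5 : ‖ut‖ ^ 2 ≤ κu ^ 2 := by gcongr
    rw [mul_assoc, inv_mul_eq_div, le_div_iff₀ hζ]
    rcases (sq_nonneg ‖ut‖).eq_or_lt with h0 | h0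
    · rw [← h0, zero_mul]; positivity
    · have hζκ : ζ ≤ κH := le_of_mul_le_mul_right h4 h0
      nlinarith
  have hdiff : ‖u - ut‖ ≤ ζ⁻¹ * ‖g - g'‖ := by
    have hnull : Matrix.toEuclideanLin A (u - ut) = 0 := by rw [map_sub, hu, hut, sub_zero]
    refine norm_le_of_coercive hζ hnull (hpd _ hnull) (z := y - yt) ?_
    have hBsub : Matrix.toEuclideanLin B (u - ut)
        = Matrix.toEuclideanLin B (u + v) - Matrix.toEuclideanLin B (ut + v) := by
      rw [← map_sub, add_sub_add_right_eq_sub]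
    rw [hBsub, map_sub, sub_add_sub_comm, hsys, hsyst]
    abel
  have htri : ‖u‖ ≤ ‖ut‖ + ‖u - ut‖ := by simpa using norm_add_le ut (u - ut)
  have hdiffsq : ‖u - ut‖ ^ 2 ≤ ζ⁻¹ * ζ⁻¹ * ‖g - g'‖ ^ 2 :=
    (pow_le_pow_left₀ (norm_nonneg _) hdiff 2).trans_eq (by ring)
  have := norm_nonneg u
  nlinarith [sq_nonneg (‖ut‖ - ‖u - ut‖)]

/-- A nonnegative variable dominated by an affine function of `log (1 + X)` is integrable, and its
mean is bounded through that of `X`. -/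
lemma integrable_and_integral_le_of_le_log {Ω : Type*} {m0 : MeasurableSpace Ω} (μ : Measure Ω)
    [IsProbabilityMeasure μ] {X Y : Ω → ℝ} {D Q a : ℝ} (hQ : 0 ≤ Q) (ha : 0 ≤ a)
    (hX0 : ∀ ω, 0 ≤ X ω) (hXi : Integrable X μ) (hXle : ∫ ω, X ω ∂μ ≤ 2 * a)
    (hYm : Measurable Y) (hY0 : ∀ ω, 0 ≤ Y ω) (hY : ∀ ω, Y ω ≤ D + Q * Real.log (1 + X ω)) :
    Integrable Y μ ∧ ∫ ω, Y ω ∂μ ≤ D + 2 * Q * Real.log (1 + a) := by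
  have hY' : ∀ ω, Y ω ≤ D + Q * (Real.log (1 + 2 * a) - 2 * a / (1 + 2 * a))
      + Q / (1 + 2 * a) * X ω := fun ω => by
    have h := mul_le_mul_of_nonneg_left
      (log_one_add_le_tangent (hX0 ω) (by positivity : 0 ≤ 2 * a)) hQ
    refine (hY ω).trans ((add_le_add_right h D).trans_eq (by ring))
  have hBint : Integrable (fun ω => D + Q * (Real.log (1 + 2 * a) - 2 * a / (1 + 2 * a))
      + Q / (1 + 2 * a) * X ω) μ := (integrable_const _).add (hXi.const_mul _)
  have hYi : Integrable Y μ :=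
    hBint.mono' hYm.aestronglyMeasurable (Filter.Eventually.of_forall fun ω => by
      rw [Real.norm_of_nonneg (hY0 ω)]
      exact hY' ω)
  refine ⟨hYi, (integral_mono hYi hBint hY').trans ?_⟩
  rw [integral_const_add_const_mul μ hXi]
  have h1 : Q / (1 + 2 * a) * ∫ ω, X ω ∂μ ≤ Q / (1 + 2 * a) * (2 * a) := by gcongr
  have h2 := mul_le_mul_of_nonneg_left (log_one_add_two_mul_le ha) hQ
  have h3 : D + Q * (Real.log (1 + 2 * a) - 2 * a / (1 + 2 * a)) + Q / (1 + 2 * a) * (2 * a)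
      = D + Q * Real.log (1 + 2 * a) := by ring
  linarith

lemma high_probability_constant_le {ν σ δ q κ N : ℝ} (hν : 0 < ν) (hσ : σ ∈ Set.Ioo (0 : ℝ) 1)
    (hδ : δ ∈ Set.Ioo (0 : ℝ) 1) (hq : 0 ≤ q) (hκ : 0 ≤ κ) (hN : 0 < N) :
    1 / N * ((q + 2 * κ / ν / δ) * (2 * κ / ν))
      ≤ 2 * (ν * σ * q + 2 * κ) * κ / (ν ^ 2 * σ ^ 2 * δ * N) := by
  obtain ⟨hσ0, hσ1⟩ := hσ
  obtain ⟨hδ0, hδ1⟩ := hδ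
  have hσδ : σ ^ 2 * δ ≤ σ := by
    have := mul_le_one₀ hσ1.le hδ0.le hδ1.le
    nlinarith
  have hσκ : σ ^ 2 * κ ≤ κ := mul_le_of_le_one_left hκ (pow_le_one₀ hσ0.le hσ1.le)
  calc 1 / N * ((q + 2 * κ / ν / δ) * (2 * κ / ν))
      = 2 * (ν * (σ ^ 2 * δ) * q + 2 * (σ ^ 2 * κ)) * κ / (ν ^ 2 * σ ^ 2 * δ * N) := by
        field_simp
    _ ≤ 2 * (ν * σ * q + 2 * κ) * κ / (ν ^ 2 * σ ^ 2 * δ * N) := by gcongr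

/-- High-probability complexity bound on the average constraint
violation for the two-stepsize stochastic SQP method with adaptive stepsizes. -/
theorem stmt17 {m n : ℕ} (hm : 1 ≤ m) (hmn : m ≤ n)
    {Ω : Type*} {m0 : MeasurableSpace Ω} (μ : Measure Ω) [IsProbabilityMeasure μ]
    (ℱ : Filtration ℕ m0)
    -- problem data
    (f : EuclideanSpace ℝ (Fin n) → ℝ)
    (gradf : EuclideanSpace ℝ (Fin n) → EuclideanSpace ℝ (Fin n))
    (c : EuclideanSpace ℝ (Fin n) → EuclideanSpace ℝ (Fin m))
    (gradc : Fin m → EuclideanSpace ℝ (Fin n) → EuclideanSpace ℝ (Fin n))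
    (flow L κg κc s ζ κH M η ν θ σ bm1 qm1 : ℝ) (γ : Fin m → ℝ)
    (hL : 0 < L) (hκg : 0 < κg) (hκc : 0 < κc) (hs : 0 < s) (hζ : 0 < ζ)
    (hκH : 0 < κH) (hM : 0 < M) (hη : 0 < η) (hν : 0 < ν) (hθ : 0 < θ)
    (hbm1 : 0 < bm1) (hqm1 : 0 < qm1)
    (hσ : σ ∈ Set.Ioo (0 : ℝ) 1) (hγ : ∀ i, 0 < γ i)
    (hf : ∀ z, HasGradientAt f (gradf z) z)
    (hflow : ∀ z, flow ≤ f z)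
    (hfLip : ∀ z z', ‖gradf z - gradf z'‖ ≤ L * ‖z - z'‖)
    (hgradb : ∀ z, ‖gradf z‖ ≤ κg)
    (hc : ∀ i z, HasGradientAt (fun w => c w i) (gradc i z) z)
    (hcb : ∀ z, l1Norm (c z) ≤ κc)
    (hcLip : ∀ i z z', ‖gradc i z - gradc i z'‖ ≤ γ i * ‖z - z'‖)
    -- algorithm iterates
    (x0 : EuclideanSpace ℝ (Fin n))
    (x u utrue g v : ℕ → Ω → EuclideanSpace ℝ (Fin n))
    (y ytrue : ℕ → Ω → EuclideanSpace ℝ (Fin m))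
    (H : ℕ → Ω → Matrix (Fin n) (Fin n) ℝ)
    (α : ℕ → Ω → ℝ) (b q : ℕ → Ω → ℝ)
    (hx0 : ∀ ω, x 0 ω = x0)
    (hxmeas : ∀ k, StronglyMeasurable[ℱ k] (x k))
    (hHmeas : ∀ k i j, StronglyMeasurable[ℱ k] (fun ω => H k ω i j))
    (hHnorm : ∀ k ω (z : EuclideanSpace ℝ (Fin n)),
      ‖Matrix.toEuclideanLin (H k ω) z‖ ≤ κH * ‖z‖)
    (hHpd : ∀ k ω (z : EuclideanSpace ℝ (Fin n)),
      Matrix.toEuclideanLin (Jmat gradc (x k ω)) z = 0 →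
      ζ * ‖z‖ ^ 2 ≤ ⟪z, Matrix.toEuclideanLin (H k ω) z⟫)
    (hsv : ∀ k ω (z : EuclideanSpace ℝ (Fin m)),
      s * ‖z‖ ≤ ‖Matrix.toEuclideanLin (Jmat gradc (x k ω))ᵀ z‖)
    (hgmeas : ∀ k, StronglyMeasurable[ℱ (k + 1)] (g k))
    (hgmean : ∀ k, μ[g k | ℱ k] =ᵐ[μ] fun ω => gradf (x k ω))
    (hgvarint : ∀ k, Integrable (fun ω => ‖g k ω - gradf (x k ω)‖ ^ 2) μ)
    (hgvar : ∀ k, ∀ᵐ ω ∂μ,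
      (μ[fun ω' => ‖g k ω' - gradf (x k ω')‖ ^ 2 | ℱ k]) ω ≤ M)
    (humeas : ∀ k, StronglyMeasurable[ℱ (k + 1)] (u k))
    (hymeas : ∀ k, StronglyMeasurable[ℱ (k + 1)] (y k))
    (hvmeas : ∀ k, StronglyMeasurable[ℱ k] (v k))
    (hutmeas : ∀ k, StronglyMeasurable[ℱ k] (utrue k))
    (hytmeas : ∀ k, StronglyMeasurable[ℱ k] (ytrue k))
    (hJu : ∀ k ω, Matrix.toEuclideanLin (Jmat gradc (x k ω)) (u k ω) = 0)
    (hvrange : ∀ k ω, ∃ z : EuclideanSpace ℝ (Fin m),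
      v k ω = Matrix.toEuclideanLin (Jmat gradc (x k ω))ᵀ z)
    (hJp : ∀ k ω, Matrix.toEuclideanLin (Jmat gradc (x k ω)) (u k ω + v k ω)
      = -(c (x k ω)))
    (hsys : ∀ k ω, Matrix.toEuclideanLin (H k ω) (u k ω + v k ω)
      + Matrix.toEuclideanLin (Jmat gradc (x k ω))ᵀ (y k ω) = -(g k ω))
    (hJut : ∀ k ω, Matrix.toEuclideanLin (Jmat gradc (x k ω)) (utrue k ω) = 0)
    (hsyst : ∀ k ω, Matrix.toEuclideanLin (H k ω) (utrue k ω + v k ω)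
      + Matrix.toEuclideanLin (Jmat gradc (x k ω))ᵀ (ytrue k ω) = -(gradf (x k ω)))
    -- adaptive accumulators and stepsizes
    (hb : ∀ k ω, b k ω = Real.sqrt ((prevSeq bm1 b k ω) ^ 2 + ‖u k ω‖ ^ 2))
    (hq : ∀ k ω, q k ω = Real.sqrt ((prevSeq qm1 q k ω) ^ 2 + l1Norm (c (x k ω))))
    (hαmeas : ∀ k, StronglyMeasurable[ℱ (k + 1)] (α k))
    (hα : ∀ k ω, α k ω ∈ Set.Icc (ν / q k ω) (ν / q k ω + min (θ / b k ω) (θ / q k ω)))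
    (hupdate : ∀ k ω, x (k + 1) ω = x k ω + α k ω • ((η / b k ω) • u k ω + v k ω))
    -- constants
    (κv κu κβ τmin Γ κ₃ κ₄ κ₅ κ₆ : ℝ)
    (hκv : κv = max (1 / s) (κc / s ^ 2))
    (hκu : κu = ζ⁻¹ * κg + ζ⁻¹ * κH * κv * κc)
    (hκβ : κβ = η / bm1)
    (hΓ : Γ = ∑ i, γ i)
    (hτmin : τmin = (1 - σ) / (κv * (κβ * κH * κu + κg)))
    (hκ₃ : κ₃ = ζ⁻¹ * (κH * κu ^ 2 + ζ⁻¹ * M))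
    (hκ₄ : κ₄ = max (ζ⁻¹ * κH ^ 2) (κβ * (1 + 2 * κu) * κH ^ 2 * κv * τmin / σ))
    (hκ₅ : κ₅ = (ν + θ) ^ 2 * (κv * (τmin * L + Γ) + 4) / 2)
    (hκ₆ : κ₆ = η ^ 2 * (ν + θ) ^ 2 * (τmin * L + Γ) / (2 * qm1 ^ 2)
      + 3 * η ^ 2 * κ₃ * κ₄ * (ν + θ) ^ 2 / (2 * ν * qm1 * bm1)
      + 3 * κ₄ * θ ^ 2 * (η ^ 2 + κβ ^ 2 * κ₃) / (2 * η * ν)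
      + 3 * ζ⁻¹ * M * κ₄ * θ ^ 2 * κβ / (2 * ν * qm1 * bm1 ^ 2))
    (K : ℕ) (hK : 1 ≤ K) (κ₇ : ℝ)
    (hκ₇ : κ₇ = τmin * (f x0 - flow) + l1Norm (c x0)
      + κ₅ * Real.log (1 + κc * K / qm1 ^ 2)
      + κ₆ * Real.log (1 + ζ⁻¹ * (κH * κu ^ 2 + ζ⁻¹ * M) * K / bm1 ^ 2))
    (δ₁ : ℝ) (hδ₁ : δ₁ ∈ Set.Ioo (0 : ℝ) 1) :
    ∃ A : Set Ω, MeasurableSet A ∧ ENNReal.ofReal (1 - δ₁) ≤ μ A ∧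
      ∫ ω in A, (1 / (K : ℝ)) * ∑ k ∈ Finset.range K, l1Norm (c (x k ω)) ∂μ
        ≤ 2 * (ν * σ * qm1 + 2 * κ₇) * κ₇ / (ν ^ 2 * σ ^ 2 * δ₁ * K) := by
  have hσ0 : 0 < σ := hσ.1
  have hσ1 : 0 < 1 - σ := sub_pos.2 hσ.2
  have hδ0 : 0 < δ₁ := hδ₁.1
  have hKpos : (0 : ℝ) < K := by exact_mod_cast hK
  have hκv0 : 0 < κv := by rw [hκv]; exact lt_max_of_lt_left (by positivity)
  have hκu0 : 0 < κu := by rw [hκu]; positivity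
  have hκβ0 : 0 < κβ := by rw [hκβ]; positivity
  have hΓ0 : 0 ≤ Γ := by rw [hΓ]; exact Finset.sum_nonneg fun i _ => (hγ i).le
  have hτ0 : 0 < τmin := by rw [hτmin]; positivity
  have hκ₃0 : 0 < κ₃ := by rw [hκ₃]; positivity
  have hκ₄0 : 0 < κ₄ := by rw [hκ₄]; exact lt_max_of_lt_left (by positivity)
  set P := (ν + θ) ^ 2 * (κv * Γ + 4) / 2 with hP
  set Q := η ^ 2 * (ν + θ) ^ 2 * Γ / (2 * qm1 ^ 2) with hQ
  have hP0 : 0 ≤ P := by positivity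
  have hQ0 : 0 ≤ Q := by positivity
  have hPκ₅ : P ≤ κ₅ := by
    rw [hκ₅, hP]
    gcongr
    exact le_add_of_nonneg_left (by positivity)
  have hQκ₆ : Q ≤ κ₆ := by
    have hQ' : Q ≤ η ^ 2 * (ν + θ) ^ 2 * (τmin * L + Γ) / (2 * qm1 ^ 2) := by
      rw [hQ]
      gcongr
      exact le_add_of_nonneg_left (by positivity)
    rw [hκ₆, add_assoc, add_assoc]
    exact hQ'.trans (le_add_of_nonneg_right (by positivity))
  have hκ₅0 : 0 < κ₅ := by rw [hκ₅]; positivity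
  -- accumulators as explicit square roots
  have hR0 : ∀ k ω, 0 ≤ l1Norm (c (x k ω)) := fun k ω => l1Norm_nonneg _
  have hq' := accumulator_eq_sqrt (r := fun k ω => l1Norm (c (x k ω))) hR0 hq
  have hb' := accumulator_eq_sqrt (r := fun k ω => ‖u k ω‖ ^ 2) (fun k ω => sq_nonneg _) hb
  have hqle : ∀ k ω, qm1 ≤ q k ω := fun k ω => by
    rw [hq' k ω]
    exact Real.le_sqrt_of_sq_le (le_add_of_nonneg_right (Finset.sum_nonneg fun j _ => hR0 j ω))
  -- normal steps
  have hvle : ∀ k ω, ‖v k ω‖ ≤ s⁻¹ * l1Norm (c (x k ω)) := fun k ω => by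
    have h := norm_le_of_mem_range_transpose hs (hsv k ω) (hvrange k ω)
    have hJv : Matrix.toEuclideanLin (Jmat gradc (x k ω)) (v k ω) = -(c (x k ω)) := by
      rw [← hJp k ω, map_add, hJu k ω, zero_add]
    rw [hJv, norm_neg] at h
    exact h.trans (by gcongr; exact norm_le_l1Norm _)
  have hvsq : ∀ k ω, ‖v k ω‖ ^ 2 ≤ κv * l1Norm (c (x k ω)) := fun k ω => by
    have hcK := hcb (x k ω)
    have h0 := hR0 k ω
    calc ‖v k ω‖ ^ 2 ≤ (s⁻¹ * l1Norm (c (x k ω))) ^ 2 := by gcongr; exact hvle k ω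
      _ = l1Norm (c (x k ω)) / s ^ 2 * l1Norm (c (x k ω)) := by field_simp
      _ ≤ κc / s ^ 2 * l1Norm (c (x k ω)) := by gcongr
      _ ≤ κv * l1Norm (c (x k ω)) := by
        gcongr
        rw [hκv]
        exact le_max_right _ _
  -- one-step recursion of the constraint violation
  have hrec : ∀ ω k, l1Norm (c (x (k + 1) ω)) ≤ l1Norm (c (x k ω))
      - ν * (l1Norm (c (x k ω)) / q k ω) + P * (l1Norm (c (x k ω)) / q k ω ^ 2)
      + Q * (‖u k ω‖ ^ 2 / b k ω ^ 2) := by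
    intro ω k
    have hd : Matrix.toEuclideanLin (Jmat gradc (x k ω)) ((η / b k ω) • u k ω + v k ω)
        = -(c (x k ω)) := by
      rw [← hJp k ω, map_add, map_add, map_smul, hJu k ω, smul_zero]
    have horth : ⟪(η / b k ω) • u k ω, v k ω⟫ = 0 := by
      obtain ⟨z, hz⟩ := hvrange k ω
      rw [hz, inner_toEuclideanLin_transpose, map_smul, hJu k ω, smul_zero, inner_zero_left]
    have hnorm : ‖(η / b k ω) • u k ω + v k ω‖ ^ 2
        = (η / b k ω) ^ 2 * ‖u k ω‖ ^ 2 + ‖v k ω‖ ^ 2 := by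
      rw [norm_add_sq_real, horth, norm_smul, mul_pow, Real.norm_eq_abs, sq_abs]
      ring
    have hstep := l1Norm_step_le hc hcLip hd (α k ω)
    rw [← hupdate k ω, hnorm, ← hΓ] at hstep
    refine hstep.trans (violation_recursion_le hν hθ hκv0.le hΓ0 hqm1 (hqle k ω) (hR0 k ω)
      (sq_nonneg _) (hvsq k ω) (hα k ω).1 ?_)
    rw [add_div]
    exact (hα k ω).2.trans (by gcongr; exact min_le_right _ _)
  -- second moments of the tangential steps
  set N : ℕ → Ω → ℝ := fun k ω => ‖g k ω - gradf (x k ω)‖ ^ 2 with hN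
  have husq : ∀ k ω, ‖u k ω‖ ^ 2 ≤ 2 * (ζ⁻¹ * κH * κu ^ 2 + ζ⁻¹ * ζ⁻¹ * N k ω) := fun k ω => by
    refine sq_norm_tangential_le hζ hκH.le (hHnorm k ω) (hHpd k ω) (hJu k ω) (hJut k ω)
      (hsys k ω) (hsyst k ω) ?_
    have hsκ : s⁻¹ ≤ κv := by rw [hκv, ← one_div]; exact le_max_left _ _
    have hvb : ‖v k ω‖ ≤ κv * κc :=
      (hvle k ω).trans (mul_le_mul hsκ (hcb _) (hR0 k ω) hκv0.le)
    calc ζ⁻¹ * (‖gradf (x k ω)‖ + κH * ‖v k ω‖) ≤ ζ⁻¹ * (κg + κH * (κv * κc)) := by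
          gcongr
          exact hgradb _
      _ = κu := by rw [hκu]; ring
  have hNint : ∀ k, ∫ ω, N k ω ∂μ ≤ M := fun k => by
    rw [← integral_condExp (ℱ.le k)]
    refine (integral_mono_ae integrable_condExp (integrable_const M) (hgvar k)).trans ?_
    simp
  set X : Ω → ℝ := fun ω =>
    (∑ k ∈ Finset.range K, 2 * (ζ⁻¹ * κH * κu ^ 2 + ζ⁻¹ * ζ⁻¹ * N k ω)) / bm1 ^ 2 with hX
  set a := κ₃ * K / bm1 ^ 2 with ha
  have ha0 : 0 ≤ a := by positivity
  have hXterm : ∀ k, Integrable (fun ω => 2 * (ζ⁻¹ * κH * κu ^ 2 + ζ⁻¹ * ζ⁻¹ * N k ω)) μ :=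
    fun k => ((integrable_const _).add ((hgvarint k).const_mul _)).const_mul _
  have hXint : Integrable X μ := (integrable_finsetSum _ fun k _ => hXterm k).div_const _
  have hXle : ∫ ω, X ω ∂μ ≤ 2 * a := by
    have hterm : ∀ k, ∫ ω, 2 * (ζ⁻¹ * κH * κu ^ 2 + ζ⁻¹ * ζ⁻¹ * N k ω) ∂μ ≤ 2 * κ₃ := fun k => by
      rw [integral_const_mul, integral_const_add_const_mul μ (hgvarint k)]
      have h := mul_le_mul_of_nonneg_left (hNint k) (by positivity : 0 ≤ ζ⁻¹ * ζ⁻¹)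
      rw [hκ₃]
      linarith
    have hsum := Finset.sum_le_sum (s := Finset.range K) fun k _ => hterm k
    rw [Finset.sum_const, Finset.card_range, nsmul_eq_mul] at hsum
    rw [hX, integral_div, integral_finsetSum _ fun k _ => hXterm k, ha, ← mul_div_assoc]
    gcongr
    linarith
  -- pathwise bound on the scaled violations
  set T : Ω → ℝ := fun ω => ∑ k ∈ Finset.range K, l1Norm (c (x k ω)) / q k ω with hT
  set D := l1Norm (c x0) + P * Real.log (1 + κc * K / qm1 ^ 2) with hD
  have hpath : ∀ ω, ν * T ω ≤ D + Q * Real.log (1 + X ω) := by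
    intro ω
    have h := sum_div_sqrt_le_of_recursion hP0 hQ0 hqm1 hbm1 (fun k => hR0 k ω)
      (fun k => sq_nonneg ‖u k ω‖) (fun k => hq' k ω) (fun k => hb' k ω) (hrec ω) K
    rw [hx0 ω] at h
    have hRsum : ∑ k ∈ Finset.range K, l1Norm (c (x k ω)) ≤ κc * K := by
      refine (Finset.sum_le_sum fun k _ => hcb (x k ω)).trans_eq ?_
      rw [Finset.sum_const, Finset.card_range, nsmul_eq_mul, mul_comm]
    have hRsum0 : 0 ≤ ∑ k ∈ Finset.range K, l1Norm (c (x k ω)) :=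
      Finset.sum_nonneg fun k _ => hR0 k ω
    have hWsum0 : 0 ≤ ∑ k ∈ Finset.range K, ‖u k ω‖ ^ 2 := Finset.sum_nonneg fun k _ => sq_nonneg _
    have hlog₁ : Real.log (1 + (∑ k ∈ Finset.range K, l1Norm (c (x k ω))) / qm1 ^ 2)
        ≤ Real.log (1 + κc * K / qm1 ^ 2) := by gcongr
    have hWX : (∑ k ∈ Finset.range K, ‖u k ω‖ ^ 2) / bm1 ^ 2 ≤ X ω :=
      div_le_div_of_nonneg_right (Finset.sum_le_sum fun k _ => husq k ω) (sq_nonneg bm1)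
    have hlog₂ := Real.log_le_log (by positivity) (add_le_add_right hWX 1)
    have h₁ := mul_le_mul_of_nonneg_left hlog₁ hP0
    have h₂ := mul_le_mul_of_nonneg_left hlog₂ hQ0
    linarith
  -- measurability and integrability
  have hccont : Continuous fun z => l1Norm (c z) :=
    continuous_finsetSum _ fun i _ =>
      (continuous_iff_continuousAt.2 fun z => (hc i z).continuousAt).abs
  have hRm : ∀ k, Measurable fun ω => l1Norm (c (x k ω)) := fun k =>
    (hccont.comp_stronglyMeasurable ((hxmeas k).mono (ℱ.le k))).measurable
  have hqm : ∀ k, Measurable (q k) := fun k => by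
    rw [show q k = fun ω => √(qm1 ^ 2 + ∑ j ∈ Finset.range (k + 1), l1Norm (c (x j ω))) from
      funext (hq' k)]
    exact ((Finset.measurable_fun_sum _ fun j _ => hRm j).const_add _).sqrt
  have hTm : Measurable T := Finset.measurable_fun_sum _ fun k _ => (hRm k).div (hqm k)
  have hT0 : ∀ ω, 0 ≤ T ω := fun ω =>
    Finset.sum_nonneg fun k _ => div_nonneg (hR0 k ω) (hqm1.le.trans (hqle k ω))
  have hX0 : ∀ ω, 0 ≤ X ω := fun ω =>
    div_nonneg (Finset.sum_nonneg fun k _ => (sq_nonneg _).trans (husq k ω)) (sq_nonneg _)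
  obtain ⟨hνTi, hνTE⟩ := integrable_and_integral_le_of_le_log μ hQ0 ha0 hX0 hXint hXle
    (hTm.const_mul ν) (fun ω => mul_nonneg hν.le (hT0 ω)) hpath
  have hTi : Integrable T μ := (integrable_const_mul_iff (IsUnit.mk0 ν hν.ne') T).1 hνTi
  have hSi : Integrable (fun ω => ∑ k ∈ Finset.range K, l1Norm (c (x k ω))) μ :=
    integrable_finsetSum _ fun k _ => Integrable.of_bound (hRm k).aestronglyMeasurable κc
      (Filter.Eventually.of_forall fun ω => by
        rw [Real.norm_of_nonneg (hR0 k ω)]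
        exact hcb _)
  -- expectation of the scaled violations
  have hlogc : 0 < Real.log (1 + κc * K / qm1 ^ 2) :=
    Real.log_pos (lt_add_of_pos_right 1 (by positivity))
  have hloga : 0 ≤ Real.log (1 + a) := Real.log_nonneg (le_add_of_nonneg_right ha0)
  have hτf : 0 ≤ τmin * (f x0 - flow) := mul_nonneg hτ0.le (sub_nonneg.2 (hflow x0))
  have hκ₇' : κ₇ = τmin * (f x0 - flow) + l1Norm (c x0)
      + κ₅ * Real.log (1 + κc * K / qm1 ^ 2) + κ₆ * Real.log (1 + a) := by
    rw [hκ₇, ha, hκ₃]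
  have hl1x0 := l1Norm_nonneg (c x0)
  have hκ₇0 : 0 < κ₇ := by
    rw [hκ₇']
    have := mul_pos hκ₅0 hlogc
    have := mul_nonneg (hQ0.trans hQκ₆) hloga
    linarith
  have hTE : ∫ ω, T ω ∂μ ≤ 2 * κ₇ / ν := by
    have hQlog := mul_le_mul_of_nonneg_right hQκ₆ hloga
    rw [integral_const_mul] at hνTE
    have hPlog := mul_le_mul_of_nonneg_right hPκ₅ hlogc.le
    have := mul_pos hκ₅0 hlogc
    rw [le_div_iff₀ hν]
    linarith
  -- high-probability event
  obtain ⟨A, hAm, hAμ, hAint⟩ := exists_event_setIntegral_le μ (by positivity) hqm1.le hδ0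
    hTm hT0 hTi hSi hTE fun ω => by
      have h := sum_le_of_sum_div_sqrt hqm1 (fun k => hR0 k ω) K
      simpa only [hT, hq'] using h
  refine ⟨A, hAm, hAμ, ?_⟩
  rw [integral_const_mul]
  exact (mul_le_mul_of_nonneg_left hAint (by positivity)).trans
    (high_probability_constant_le hν hσ hδ₁ hqm1.le hκ₇0.le hKpos)
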